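/- For every τ ∈ ℍ and z ∈ ℂ, θ11(z,τ) = 0 if and only if z lies in the lattice ℤ + τℤ, i.e. z = m + nτ for some integers m, n. -/

import Mathlib

open Complex Filter

noncomputable section

/-- Jacobi theta function θ00(z,τ) = Σ_{n∈ℤ} exp(πin²τ + 2πinz). -/
def θ00 (z τ : ℂ) : ℂ :=
  ∑' n : ℤ, Complex.exp ((Real.pi : ℂ) * I * n ^ 2 * τ + 2 * (Real.pi : ℂ) * I * n * z)

/-- Jacobi theta function θ01(z,τ) = Σ_{n∈ℤ} (−1)^n exp(πin²τ + 2πinz). -/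
def θ01 (z τ : ℂ) : ℂ :=
  ∑' n : ℤ, (-1 : ℂ) ^ n *
    Complex.exp ((Real.pi : ℂ) * I * n ^ 2 * τ + 2 * (Real.pi : ℂ) * I * n * z)

/-- Jacobi theta function θ10(z,τ) = Σ_{n∈ℤ} exp(πi(n+1/2)²τ + (2n+1)πiz). -/
def θ10 (z τ : ℂ) : ℂ :=
  ∑' n : ℤ, Complex.exp ((Real.pi : ℂ) * I * (n + 1 / 2) ^ 2 * τ +
    (2 * n + 1) * (Real.pi : ℂ) * I * z)

/-- Jacobi theta function θ11(z,τ) = Σ_{n∈ℤ} (−1)^n exp(πi(n+1/2)²τ + (2n+1)πiz). -/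
def θ11 (z τ : ℂ) : ℂ :=
  ∑' n : ℤ, (-1 : ℂ) ^ n * Complex.exp ((Real.pi : ℂ) * I * (n + 1 / 2) ^ 2 * τ +
    (2 * n + 1) * (Real.pi : ℂ) * I * z)

/-- Dedekind eta function η(τ) = q^{1/24} ∏_{n≥1} (1 − qⁿ), q = exp(2πiτ). -/
def η (τ : ℂ) : ℂ :=
  Complex.exp ((Real.pi : ℂ) * I * τ / 12) *
    ∏' n : ℕ, (1 - Complex.exp (2 * (Real.pi : ℂ) * I * τ) ^ (n + 1))

/-- Weight-two quasimodular Eisenstein series G₂(τ) = 1/24 − Σ_{n≥1} σ₁(n) qⁿ. -/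
def G₂ (τ : ℂ) : ℂ :=
  1 / 24 - ∑' n : ℕ, (∑ d ∈ (n + 1).divisors, (d : ℂ)) *
    Complex.exp (2 * (Real.pi : ℂ) * I * τ) ^ (n + 1)

/-- finite q-Pochhammer symbol -/
def qP (Q : ℂ) (N : ℕ) : ℂ := ∏ k ∈ Finset.range N, (1 - Q ^ (k + 1))

/-- reciprocal of the q-Pochhammer symbol, extended by zero -/
def bP (Q : ℂ) (j : ℤ) : ℂ := if 0 ≤ j then (qP Q j.toNat)⁻¹ else 0

lemma one_sub_pow_ne {Q : ℂ} (hQ : ‖Q‖ < 1) (k : ℕ) : 1 - Q ^ (k + 1) ≠ 0 := by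
  intro h
  have h1 : Q ^ (k + 1) = 1 := (sub_eq_zero.mp h).symm
  have h2 : ‖Q‖ ^ (k + 1) < 1 := pow_lt_one₀ (norm_nonneg _) hQ (Nat.succ_ne_zero k)
  rw [← norm_pow, h1] at h2
  simp at h2

lemma qP_ne {Q : ℂ} (hQ : ‖Q‖ < 1) (N : ℕ) : qP Q N ≠ 0 :=
  Finset.prod_ne_zero_iff.mpr fun k _ => one_sub_pow_ne hQ k

lemma qP_succ (Q : ℂ) (N : ℕ) : qP Q (N + 1) = qP Q N * (1 - Q ^ (N + 1)) :=
  Finset.prod_range_succ _ _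

lemma bP_rec {Q : ℂ} (hQ : ‖Q‖ < 1) (j : ℤ) : bP Q (j - 1) = (1 - Q ^ j) * bP Q j := by
  rcases lt_trichotomy j 0 with h | h | h
  · simp [bP, not_le.mpr h, show ¬ (1 ≤ j) by omega]
  · subst h; simp [bP]
  · obtain ⟨m, rfl⟩ : ∃ m : ℕ, j = (m : ℤ) + 1 := ⟨(j - 1).toNat, by omega⟩
    have e1 : ((m : ℤ) + 1 - 1).toNat = m := by omega
    have e2 : ((m : ℤ) + 1).toNat = m + 1 := by omega
    have e3 : Q ^ ((m : ℤ) + 1) = Q ^ (m + 1) := by exact_mod_cast zpow_natCast Q (m + 1)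
    have h1 := one_sub_pow_ne hQ m
    have h2 := qP_ne hQ m
    rw [bP, bP, if_pos (by omega), if_pos (by omega), e1, e2, e3, qP_succ]
    field_simp

lemma finite_triple {Q w : ℂ} (hQ : ‖Q‖ < 1) (hQ0 : Q ≠ 0) (hw : w ≠ 0) {t : ℤ → ℂ}
    (h0 : t 0 = 1) (ht : ∀ n, t (n + 1) = -(Q ^ (n + 1) * w * t n)) (N : ℕ) :
    HasSum (fun n : ℤ => t n * (qP Q (2 * N) * bP Q (N - n) * bP Q (N + n)))
      (∏ k ∈ Finset.range N, ((1 - w * Q ^ (k + 1)) * (1 - w⁻¹ * Q ^ k))) := by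
  induction N with
  | zero =>
    have := hasSum_single (f := fun n : ℤ =>
      t n * (qP Q (2 * 0) * bP Q (((0 : ℕ) : ℤ) - n) * bP Q (((0 : ℕ) : ℤ) + n))) 0 (by
        intro n hn
        rcases lt_or_gt_of_ne hn with h | h
        · simp [bP, not_le.mpr h]
        · simp [bP, not_le.mpr h])
    simpa [h0, bP, qP] using this
  | succ N ih =>
    rw [Finset.prod_range_succ]
    have hs1 := ((Equiv.addRight (-1 : ℤ)).hasSum_iff).mpr ih
    have hs2 := ((Equiv.addRight (1 : ℤ)).hasSum_iff).mpr ih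
    have h := ((ih.mul_left (1 + Q ^ (2 * N + 1))).sub (hs1.mul_left (w * Q ^ (N + 1)))).sub
      (hs2.mul_left (w⁻¹ * Q ^ N))
    convert h using 1
    · rfl
    · funext n
      simp only [Function.comp, Equiv.coe_addRight]
      have t1 : t n = -(Q ^ n * w * t (n + -1)) := by
        have := ht (n + -1)
        simpa using this
      have t2 := ht n
      have r1 := bP_rec hQ ((N : ℤ) + 1 - n)
      have r2 := bP_rec hQ ((N : ℤ) + 1 + n)
      have r3 := bP_rec hQ ((N : ℤ) + 1 - n - 1)
      have r4 := bP_rec hQ ((N : ℤ) + 1 + n - 1)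
      have e1 : (N : ℤ) - n = N + 1 - n - 1 := by ring
      have e2 : (N : ℤ) + n = N + 1 + n - 1 := by ring
      have e3 : (N : ℤ) - (n + -1) = N + 1 - n := by ring
      have e4 : (N : ℤ) + (n + -1) = N + 1 + n - 1 - 1 := by ring
      have e5 : (N : ℤ) - (n + 1) = N + 1 - n - 1 - 1 := by ring
      have e6 : (N : ℤ) + (n + 1) = N + 1 + n := by ring
      rw [e1, e2, e3, e4, e5, e6, r3, r4, r1, r2, show 2 * (N + 1) = 2 * N + 1 + 1 by ring,
        qP_succ, qP_succ, t2]
      push_cast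
      generalize bP Q ((N : ℤ) + 1 - n) = A
      generalize bP Q ((N : ℤ) + 1 + n) = B
      generalize qP Q (2 * N) = C
      have z1 : Q ^ ((N : ℤ) + 1 - n) = Q ^ N * Q / Q ^ n := by
        rw [zpow_sub₀ hQ0, zpow_add₀ hQ0]; simp
      have z2 : Q ^ ((N : ℤ) + 1 + n) = Q ^ N * Q * Q ^ n := by
        rw [zpow_add₀ hQ0, zpow_add₀ hQ0]; simp
      have z3 : Q ^ ((N : ℤ) + 1 - n - 1) = Q ^ N / Q ^ n := by
        rw [zpow_sub₀ hQ0, z1]; field_simp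
      have z4 : Q ^ ((N : ℤ) + 1 + n - 1) = Q ^ N * Q ^ n := by
        rw [zpow_sub₀ hQ0, z2]; field_simp
      have z5 : Q ^ (n + 1) = Q ^ n * Q := by rw [zpow_add₀ hQ0]; simp
      have hn : Q ^ n ≠ 0 := zpow_ne_zero _ hQ0
      rw [z1, z2, z3, z4, z5, t1]
      generalize t (n + -1) = T
      generalize Q ^ n = X at *
      field_simp
      ring
    · generalize (∏ k ∈ Finset.range N, (1 - w * Q ^ (k + 1)) * (1 - w⁻¹ * Q ^ k)) = P
      field_simp
      ring

lemma qP_lim {Q : ℂ} (hQ : ‖Q‖ < 1) : ∃ L : ℂ, L ≠ 0 ∧ Tendsto (qP Q) atTop (nhds L) := by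
  have hs : Summable fun k : ℕ => ‖-Q ^ (k + 1)‖ := by
    simpa using (summable_nat_add_iff 1).mpr (summable_geometric_of_lt_one (norm_nonneg _) hQ)
  refine ⟨∏' k : ℕ, (1 + -Q ^ (k + 1)), ?_, ?_⟩
  · refine tprod_one_add_ne_zero_of_summable (fun k => ?_) hs
    simpa [sub_eq_add_neg] using one_sub_pow_ne hQ k
  · have := (multipliable_one_add_of_summable hs).tendsto_prod_tprod_nat
    refine this.congr fun N => ?_
    simp [qP, sub_eq_add_neg]

lemma bP_lim {Q L : ℂ} (hL : L ≠ 0) (h : Tendsto (qP Q) atTop (nhds L)) :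
    Tendsto (bP Q) atTop (nhds L⁻¹) := by
  have h1 : Tendsto (fun j : ℤ => (qP Q j.toNat)⁻¹) atTop (nhds L⁻¹) := by
    refine ((h.inv₀ hL).comp ?_)
    refine tendsto_atTop.mpr fun b => ?_
    filter_upwards [eventually_ge_atTop (b : ℤ)] with j hj
    omega
  refine h1.congr' ?_
  filter_upwards [eventually_ge_atTop (0 : ℤ)] with j hj
  rw [bP, if_pos hj]

lemma bdd_of_lim {u : ℕ → ℂ} {L : ℂ} (h : Tendsto u atTop (nhds L)) :
    ∃ C, 0 ≤ C ∧ ∀ n, ‖u n‖ ≤ C := by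
  obtain ⟨C, hC⟩ := (Metric.isBounded_range_of_tendsto u h).exists_norm_le
  have := fun n => hC (u n) ⟨n, rfl⟩
  exact ⟨C, (norm_nonneg _).trans (this 0), this⟩

lemma triple_lim {Q w : ℂ} (hQ : ‖Q‖ < 1) (hQ0 : Q ≠ 0) (hw : w ≠ 0) {t : ℤ → ℂ}
    (h0 : t 0 = 1) (ht : ∀ n, t (n + 1) = -(Q ^ (n + 1) * w * t n)) (hs : Summable t) :
    ∃ c : ℂ, c ≠ 0 ∧ Tendsto (fun N : ℕ =>
      ∏ k ∈ Finset.range N, ((1 - w * Q ^ (k + 1)) * (1 - w⁻¹ * Q ^ k))) atTop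
      (nhds ((∑' n, t n) * c)) := by
  obtain ⟨L, hL, hl⟩ := qP_lim hQ
  have hb := bP_lim hL hl
  obtain ⟨C, hC0, hC⟩ := bdd_of_lim hl
  obtain ⟨D, hD0, hD⟩ := bdd_of_lim (hl.inv₀ hL)
  have hD' : ∀ j, ‖bP Q j‖ ≤ D := by
    intro j
    rw [bP]
    split_ifs
    · exact hD _
    · simpa using hD0
  refine ⟨L * L⁻¹ * L⁻¹, by simp [hL], ?_⟩
  rw [← tsum_mul_right]
  have hT := tendsto_tsum_of_dominated_convergence (𝓕 := atTop)
    (f := fun (N : ℕ) (n : ℤ) => t n * (qP Q (2 * N) * bP Q (N - n) * bP Q (N + n)))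
    (g := fun n => t n * (L * L⁻¹ * L⁻¹)) (bound := fun n => ‖t n‖ * (C * D * D))
    (hs.norm.mul_right _) ?_ ?_
  · refine hT.congr fun N => ?_
    exact (finite_triple hQ hQ0 hw h0 ht N).tsum_eq
  · intro n
    refine Tendsto.const_mul _ (Tendsto.mul (Tendsto.mul ?_ ?_) ?_)
    · exact hl.comp (tendsto_id.const_mul_atTop' (by norm_num))
    · refine hb.comp ?_
      simpa [sub_eq_add_neg] using tendsto_atTop_add_const_right atTop (-n) (tendsto_natCast_atTop_atTop (R := ℤ))
    · exact hb.comp (tendsto_atTop_add_const_right atTop n (tendsto_natCast_atTop_atTop (R := ℤ)))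
  · refine Eventually.of_forall fun N n => ?_
    rw [norm_mul, norm_mul, norm_mul]
    have := hC (2 * N)
    have h1 := hD' (N - n)
    have h2 := hD' (N + n)
    gcongr

lemma triple_zero_iff {Q w : ℂ} (hQ : ‖Q‖ < 1) (hQ0 : Q ≠ 0) (hw : w ≠ 0) {t : ℤ → ℂ}
    (h0 : t 0 = 1) (ht : ∀ n, t (n + 1) = -(Q ^ (n + 1) * w * t n)) (hs : Summable t) :
    ∑' n, t n = 0 ↔ ∃ n : ℤ, w = Q ^ n := by
  obtain ⟨c, hc, hT⟩ := triple_lim hQ hQ0 hw h0 ht hs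
  have hg := summable_geometric_of_lt_one (norm_nonneg _) hQ
  constructor
  · intro hz
    by_contra! hne
    have f1 : ∀ k : ℕ, 1 + -(w * Q ^ (k + 1)) ≠ 0 := by
      intro k hk
      apply hne (-((k + 1 : ℕ) : ℤ))
      rw [zpow_neg, zpow_natCast]
      exact eq_inv_of_mul_eq_one_left (by linear_combination -hk)
    have f2 : ∀ k : ℕ, 1 + -(w⁻¹ * Q ^ k) ≠ 0 := by
      intro k hk
      apply hne k
      rw [zpow_natCast]
      field_simp at hk
      linear_combination hk
    have s1 : Summable fun k : ℕ => ‖-(w * Q ^ (k + 1))‖ := by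
      simpa using ((summable_nat_add_iff 1).mpr hg).mul_left ‖w‖
    have s2 : Summable fun k : ℕ => ‖-(w⁻¹ * Q ^ k)‖ := by
      simpa using hg.mul_left ‖w‖⁻¹
    have p1 := tprod_one_add_ne_zero_of_summable f1 s1
    have p2 := tprod_one_add_ne_zero_of_summable f2 s2
    have l1 := (multipliable_one_add_of_summable s1).tendsto_prod_tprod_nat
    have l2 := (multipliable_one_add_of_summable s2).tendsto_prod_tprod_nat
    have l3 := l1.mul l2
    simp only [← Finset.prod_mul_distrib, ← sub_eq_add_neg] at l3
    have := tendsto_nhds_unique hT l3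
    rw [hz, zero_mul] at this
    simp only [← sub_eq_add_neg] at p1 p2
    exact mul_ne_zero p1 p2 this.symm
  · rintro ⟨n, hn⟩
    have hk : ∃ k : ℕ, (1 - w * Q ^ (k + 1)) * (1 - w⁻¹ * Q ^ k) = 0 := by
      rcases le_or_gt 0 n with h | h
      · refine ⟨n.toNat, mul_eq_zero_of_right _ ?_⟩
        rw [← zpow_natCast, Int.toNat_of_nonneg h, ← hn, inv_mul_cancel₀ hw, sub_self]
      · refine ⟨(-n - 1).toNat, mul_eq_zero_of_left ?_ _⟩
        rw [← zpow_natCast, hn, ← zpow_add₀ hQ0,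
          show n + (((-n - 1).toNat + 1 : ℕ) : ℤ) = 0 by omega]
        simp
    obtain ⟨k, hk⟩ := hk
    have hT0 : Tendsto (fun N : ℕ =>
      ∏ k ∈ Finset.range N, ((1 - w * Q ^ (k + 1)) * (1 - w⁻¹ * Q ^ k))) atTop (nhds 0) := by
      refine tendsto_const_nhds.congr' ?_
      filter_upwards [eventually_gt_atTop k] with N hN
      exact (Finset.prod_eq_zero (Finset.mem_range.mpr hN) hk).symm
    have := tendsto_nhds_unique hT hT0
    exact (mul_eq_zero.mp this).resolve_right hc

/-- The zero set of `θ11(·,τ)` is exactly the lattice `ℤ + τℤ`. -/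
theorem θ11_zero_iff_mem_lattice (τ : ℂ) (hτ : 0 < τ.im) (z : ℂ) :
    θ11 z τ = 0 ↔ ∃ m n : ℤ, z = (m : ℂ) + (n : ℂ) * τ := by
  set Q := Complex.exp (2 * (Real.pi : ℂ) * I * τ) with hQd
  set w := Complex.exp (2 * (Real.pi : ℂ) * I * z) with hwd
  have hQ : ‖Q‖ < 1 := by
    rw [hQd, Complex.norm_exp]
    simp
    positivity
  have hm1 : ∀ n : ℤ, (-1 : ℂ) ^ n = Complex.exp (n * ((Real.pi : ℂ) * I)) := by
    intro n
    rw [Complex.exp_int_mul, Complex.exp_pi_mul_I]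
  set t : ℤ → ℂ := fun n => jacobiTheta₂_term n (z + τ / 2 + 1 / 2) τ with htd
  have hs : Summable t := (summable_jacobiTheta₂_term_iff _ _).mpr hτ
  have key := triple_zero_iff (t := t) hQ (Complex.exp_ne_zero _) (w := w) (Complex.exp_ne_zero _)
    (by simp [htd, jacobiTheta₂_term]) (by
      intro n
      simp only [htd, jacobiTheta₂_term, hQd, hwd]
      rw [← Complex.exp_int_mul, ← Complex.exp_add, ← Complex.exp_add, ← neg_one_mul,
        ← Complex.exp_pi_mul_I, ← Complex.exp_add]
      congr 1
      push_cast
      ring) hs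
  have hθ : θ11 z τ = Complex.exp ((Real.pi : ℂ) * I * τ / 4 + (Real.pi : ℂ) * I * z) *
      ∑' n, t n := by
    rw [θ11, ← tsum_mul_left]
    refine tsum_congr fun n => ?_
    simp only [htd, jacobiTheta₂_term]
    rw [hm1, ← Complex.exp_add, ← Complex.exp_add]
    congr 1
    ring
  rw [hθ, mul_eq_zero, or_iff_right (Complex.exp_ne_zero _), key]
  have hpi : (2 * (Real.pi : ℂ) * I) ≠ 0 := Complex.two_pi_I_ne_zero
  constructor
  · rintro ⟨n, hn⟩
    rw [hwd, hQd, ← Complex.exp_int_mul, Complex.exp_eq_exp_iff_exists_int] at hn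
    obtain ⟨m, hm⟩ := hn
    refine ⟨m, n, mul_left_cancel₀ hpi ?_⟩
    linear_combination hm
  · rintro ⟨m, n, h⟩
    refine ⟨n, ?_⟩
    rw [hwd, hQd, ← Complex.exp_int_mul, Complex.exp_eq_exp_iff_exists_int]
    exact ⟨m, by rw [h]; ring⟩

end
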